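/- Let δ ∈ (0, 1/2) satisfy 2(1−2δ)² > 1, let c ∈ ℂ, R ≥ 0, and let f : ℂ → ℂ be continuously differentiable (in the real sense) on an open neighborhood of the closed unit disc D, such that ∂̄f(z) = c for all |z| ≤ 1 − 2δ, |∂̄f(z)| ≤ |c| for all |z| ≤ 1, and |f(z)| ≤ R for all |z| = 1. Then |c| ≤ R / (2(1−2δ)² − 1). -/

import Mathlib

/-- The anti-holomorphic derivative `∂̄f = (∂ₓf + i ∂_y f)/2` of a map `f : ℂ → ℂ`
(differentiable in the real sense). -/
noncomputable def dbar (f : ℂ → ℂ) (z : ℂ) : ℂ :=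
  (fderiv ℝ f z 1 + Complex.I * fderiv ℝ f z Complex.I) / 2

open MeasureTheory Metric Set
open scoped Interval

lemma ContDiffOn.continuousOn_dbar {f : ℂ → ℂ} {U : Set ℂ} (hU : IsOpen U)
    (hf : ContDiffOn ℝ 1 f U) : ContinuousOn (dbar f) U := by
  have h := hf.continuousOn_fderiv_of_isOpen hU le_rfl
  unfold dbar
  fun_prop

/-- **Cauchy–Pompeiu formula** on an annulus, with the area integral in polar coordinates. -/
lemma circleIntegral_sub_circleIntegral_eq_integral_dbar {f : ℂ → ℂ} {U : Set ℂ} (hU : IsOpen U)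
    (hf : ContDiffOn ℝ 1 f U) {a b : ℝ} (ha : 0 ≤ a) (hab : a ≤ b) (hbU : closedBall 0 b ⊆ U) :
    (∮ z in C(0, b), f z) - (∮ z in C(0, a), f z) =
      ∫ r in a..b, ∫ θ in (0)..(2 * Real.pi), 2 * Complex.I * r * dbar f (circleMap 0 r θ) := by
  let E : ℝ × ℝ → ℂ := fun p ↦ Complex.exp (p.2 * Complex.I)
  let P : ℝ × ℝ → ℂ := fun p ↦ p.1 * E p
  have hE (p : ℝ × ℝ) : HasFDerivAt E
      ((ContinuousLinearMap.snd ℝ ℝ ℝ).smulRight (E p * Complex.I)) p := by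
    have h : HasFDerivAt (fun p : ℝ × ℝ ↦ (p.2 : ℂ) * Complex.I)
        ((ContinuousLinearMap.snd ℝ ℝ ℝ).smulRight Complex.I) p :=
      ((ContinuousLinearMap.snd ℝ ℝ ℝ).smulRight Complex.I).hasFDerivAt.congr_of_eventuallyEq
        (.of_forall fun p ↦ by simp)
    exact h.cexp.congr_fderiv (by ext <;> simp [E])
  have hP (p : ℝ × ℝ) : HasFDerivAt P ((ContinuousLinearMap.fst ℝ ℝ ℝ).smulRight (E p) +
      (ContinuousLinearMap.snd ℝ ℝ ℝ).smulRight (P p * Complex.I)) p := by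
    have h : HasFDerivAt (fun p : ℝ × ℝ ↦ (p.1 : ℂ))
        (Complex.ofRealCLM.comp (ContinuousLinearMap.fst ℝ ℝ ℝ)) p :=
      (Complex.ofRealCLM.comp (ContinuousLinearMap.fst ℝ ℝ ℝ)).hasFDerivAt
    exact (h.mul (hE p)).congr_fderiv (by ext <;> simp [P, mul_assoc])
  have hPc (p : ℝ × ℝ) : P p = circleMap 0 p.1 p.2 := by simp [P, E, circleMap]
  have hPU : MapsTo P ([[a, b]] ×ˢ [[0, 2 * Real.pi]]) U := by
    rintro p ⟨hp, -⟩
    rw [uIcc_of_le hab] at hp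
    apply hbU
    simpa [hPc, abs_of_nonneg (ha.trans hp.1)] using hp.2
  have hEc : Continuous E := by fun_prop
  have hPcont : Continuous P := by fun_prop
  have hfP : ContinuousOn (f ∘ P) ([[a, b]] ×ˢ [[0, 2 * Real.pi]]) :=
    hf.continuousOn.comp hPcont.continuousOn hPU
  have hdP (p : ℝ × ℝ) (hp : p ∈ Ioo (min a b) (max a b) ×ˢ
      Ioo (min 0 (2 * Real.pi)) (max 0 (2 * Real.pi))) :
      HasFDerivAt (f ∘ P) ((fderiv ℝ f (P p)).comp
        ((ContinuousLinearMap.fst ℝ ℝ ℝ).smulRight (E p) +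
          (ContinuousLinearMap.snd ℝ ℝ ℝ).smulRight (P p * Complex.I))) p := by
    have hpU : P p ∈ U := hPU ⟨Ioo_subset_Icc_self hp.1, Ioo_subset_Icc_self hp.2⟩
    exact ((hf.contDiffAt (hU.mem_nhds hpU)).differentiableAt one_ne_zero).hasFDerivAt.comp p (hP p)
  have hdiv (p : ℝ × ℝ) :
      ((P p * Complex.I) • (fderiv ℝ f (P p)).comp
          ((ContinuousLinearMap.fst ℝ ℝ ℝ).smulRight (E p) +
            (ContinuousLinearMap.snd ℝ ℝ ℝ).smulRight (P p * Complex.I)) +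
        f (P p) • (Complex.I • ((ContinuousLinearMap.fst ℝ ℝ ℝ).smulRight (E p) +
            (ContinuousLinearMap.snd ℝ ℝ ℝ).smulRight (P p * Complex.I)))) (1, 0) +
      (-(E p • (fderiv ℝ f (P p)).comp
          ((ContinuousLinearMap.fst ℝ ℝ ℝ).smulRight (E p) +
            (ContinuousLinearMap.snd ℝ ℝ ℝ).smulRight (P p * Complex.I)) +
        f (P p) • (ContinuousLinearMap.snd ℝ ℝ ℝ).smulRight (E p * Complex.I))) (0, 1) =
      2 * Complex.I * p.1 * dbar f (circleMap 0 p.1 p.2) := by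
    have hL (L : ℂ →L[ℝ] ℂ) (z : ℂ) : L z = z.re * L 1 + z.im * L Complex.I := by
      simp only [← Complex.real_smul, ← map_smul, ← map_add]
      simp [Complex.re_add_im]
    have hcs : ((E p).re : ℂ) + (E p).im * Complex.I = E p := Complex.re_add_im _
    have hsq : ((E p).re : ℂ) ^ 2 + ((E p).im : ℂ) ^ 2 = 1 := by
      have : (E p).re ^ 2 + (E p).im ^ 2 = 1 := by
        simp [E, Complex.exp_ofReal_mul_I_re, Complex.exp_ofReal_mul_I_im]
      exact_mod_cast this
    rw [← hPc]
    simp only [add_apply, neg_apply, smul_apply, ContinuousLinearMap.comp_apply,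
      ContinuousLinearMap.smulRight_apply, ContinuousLinearMap.coe_fst',
      ContinuousLinearMap.coe_snd', one_smul, zero_smul, add_zero, zero_add, smul_eq_mul]
    rw [hL _ (E p), hL _ (P p * Complex.I), dbar]
    have h1 : (P p * Complex.I).re = -(p.1 * (E p).im) := by simp [P]
    have h2 : (P p * Complex.I).im = p.1 * (E p).re := by simp [P]
    have h3 : P p = p.1 * E p := rfl
    rw [h1, h2]
    generalize fderiv ℝ f (P p) = L
    rw [h3]
    generalize f (p.1 * E p) = w
    push_cast
    rw [← hcs]
    simp only [Complex.add_re, Complex.add_im, Complex.mul_re, Complex.mul_im, Complex.ofReal_re,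
      Complex.ofReal_im, Complex.I_re, Complex.I_im]
    push_cast
    linear_combination (p.1 * Complex.I * L 1 - p.1 * L Complex.I) * hsq +
      p.1 * ((E p).re * (E p).im * L 1 + (E p).im ^ 2 * L Complex.I - L Complex.I) * Complex.I_sq
  have key := integral2_divergence_prod_of_hasFDerivAt
    (fun p ↦ P p * Complex.I * (f ∘ P) p) (fun p ↦ -(E p * (f ∘ P) p)) _ _ a 0 b (2 * Real.pi)
    ((hPcont.mul continuous_const).continuousOn.mul hfP) (hEc.continuousOn.mul hfP).neg
    (fun p hp ↦ ((hP p).mul_const Complex.I).mul (hdP p hp))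
    (fun p hp ↦ ((hE p).mul (hdP p hp)).neg)
    (by
      simp only [Function.comp_apply, hdiv]
      refine ContinuousOn.integrableOn_compact (isCompact_uIcc.prod isCompact_uIcc) ?_
      refine ContinuousOn.mul (by fun_prop) ?_
      simp_rw [← hPc]
      exact (hf.continuousOn_dbar hU).comp hPcont.continuousOn hPU)
  simp only [Function.comp_apply, hdiv] at key
  rw [key]
  have hper (r : ℝ) : E (r, 2 * Real.pi) = E (r, 0) := by simp [E]
  have hPper (r : ℝ) : P (r, 2 * Real.pi) = P (r, 0) := by simp [P, hper]
  simp [hper, hPper, circleIntegral, hPc]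

/-- The key estimate (Ch3)–(Ch5) of Lemma 4.1: if `∂̄f = c` on the disc of radius `1 - 2δ`,
`|∂̄f| ≤ |c|` on the closed unit disc and `|f| ≤ R` on the unit circle, then
`|c| ≤ R / (2(1-2δ)² - 1)`. -/
theorem norm_c_le_of_dbar_eq (δ : ℝ) (hδ0 : 0 < δ) (hδ1 : δ < 1 / 2)
    (h2 : 1 < 2 * (1 - 2 * δ) ^ 2) (c : ℂ) (R : ℝ) (hR : 0 ≤ R)
    (f : ℂ → ℂ) (U : Set ℂ) (hU : IsOpen U)
    (hDU : Metric.closedBall (0 : ℂ) 1 ⊆ U) (hf : ContDiffOn ℝ 1 f U)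
    (hc : ∀ z : ℂ, ‖z‖ ≤ 1 - 2 * δ → dbar f z = c)
    (hbd : ∀ z : ℂ, ‖z‖ ≤ 1 → ‖dbar f z‖ ≤ ‖c‖)
    (hbR : ∀ z : ℂ, ‖z‖ = 1 → ‖f z‖ ≤ R) :
    ‖c‖ ≤ R / (2 * (1 - 2 * δ) ^ 2 - 1) := by
  set ρ := 1 - 2 * δ with hρ
  have hρ0 : 0 ≤ ρ := by linarith
  have hρ1 : ρ ≤ 1 := by linarith
  have hin := circleIntegral_sub_circleIntegral_eq_integral_dbar hU hf le_rfl hρ0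
    ((closedBall_subset_closedBall hρ1).trans hDU)
  have hout := circleIntegral_sub_circleIntegral_eq_integral_dbar hU hf hρ0 hρ1 hDU
  have hin' : (∮ z in C(0, ρ), f z) = 2 * Real.pi * ρ ^ 2 * Complex.I * c := by
    rw [circleIntegral.integral_radius_zero, sub_zero] at hin
    rw [hin]
    have : ∀ r ∈ [[0, ρ]], (∫ θ in (0)..(2 * Real.pi),
        2 * Complex.I * r * dbar f (circleMap 0 r θ)) = r * (4 * Real.pi * Complex.I * c) := by
      intro r hr
      rw [uIcc_of_le hρ0] at hr
      have h (θ : ℝ) : dbar f (circleMap 0 r θ) = c :=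
        hc _ (by simpa [abs_of_nonneg hr.1] using hr.2)
      simp only [h, intervalIntegral.integral_const, sub_zero, Complex.real_smul]
      push_cast
      ring
    rw [intervalIntegral.integral_congr this, intervalIntegral.integral_mul_const,
      intervalIntegral.integral_ofReal, integral_id]
    push_cast
    ring
  have hout' : ‖(∮ z in C(0, 1), f z) - (∮ z in C(0, ρ), f z)‖ ≤
      2 * Real.pi * (1 - ρ ^ 2) * ‖c‖ := by
    rw [hout]
    calc _ ≤ ∫ r in ρ..1, r * (4 * Real.pi * ‖c‖) := by
          refine intervalIntegral.norm_integral_le_of_norm_le hρ1 (.of_forall fun r hr ↦ ?_)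
            (Continuous.intervalIntegrable (by fun_prop) _ _)
          have hr0 : 0 ≤ r := hρ0.trans hr.1.le
          refine (intervalIntegral.norm_integral_le_of_norm_le_const (C := 2 * r * ‖c‖)
            fun θ _ ↦ ?_).trans_eq ?_
          · have := hbd (circleMap 0 r θ) (by simpa [abs_of_nonneg hr0] using hr.2)
            simp only [norm_mul, Complex.norm_ofNat, Complex.norm_I, mul_one, Complex.norm_real,
              Real.norm_of_nonneg hr0]
            gcongr
          · rw [sub_zero, abs_of_pos Real.two_pi_pos]
            ring
      _ = _ := by
          rw [intervalIntegral.integral_mul_const, integral_id]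
          ring
  have hR' : ‖∮ z in C(0, 1), f z‖ ≤ 2 * Real.pi * 1 * R :=
    circleIntegral.norm_integral_le_of_norm_le_const zero_le_one fun z hz ↦ hbR z (by simpa using hz)
  have hnorm : ‖∮ z in C(0, ρ), f z‖ = 2 * Real.pi * (ρ ^ 2 * ‖c‖) := by
    rw [hin']
    simp [abs_of_pos Real.pi_pos, mul_assoc]
  have htri := norm_sub_norm_le (∮ z in C(0, ρ), f z) (∮ z in C(0, 1), f z)
  rw [norm_sub_rev] at htri
  rw [le_div_iff₀ (by linarith)]
  refine le_of_mul_le_mul_left ?_ Real.two_pi_pos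
  linarith
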